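/- arXiv:2108.12445 — 4 statements merged into one kernel-verified Lean document; each statement's English description precedes it below -/
import Mathlib

section
/- (Böhning's curvature bound) For every ψ ∈ ℝ^{D−1}, the matrix A − (diag(p_ψ) − p_ψ p_ψᵀ) is positive semidefinite, where A = (1/2)(I_{D−1} − (1/D)·1 1ᵀ); i.e., the Hessian of lse is uniformly dominated by A in the Loewner order. -/
open scoped BigOperators
open Matrix

/-- The induced probability vector `(p_ψ)_j = exp(ψ_j)/(1 + Σ_k exp(ψ_k))`. -/
noncomputable def probVec {n : ℕ} (ψ : Fin n → ℝ) : Fin n → ℝ :=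
  fun j => Real.exp (ψ j) / (1 + ∑ k, Real.exp (ψ k))

/-- The Hessian matrix `diag(p_ψ) - p_ψ p_ψᵀ` of the log-sum-exp function. -/
noncomputable def lseHess {n : ℕ} (ψ : Fin n → ℝ) : Matrix (Fin n) (Fin n) ℝ :=
  Matrix.diagonal (probVec ψ) - Matrix.of (fun i j => probVec ψ i * probVec ψ j)

/-- Böhning's matrix `A = (1/2)(I_{D-1} - (1/D) 1 1ᵀ)`. -/
noncomputable def bohningA (D : ℕ) : Matrix (Fin (D - 1)) (Fin (D - 1)) ℝ :=
  (1 / 2 : ℝ) • ((1 : Matrix (Fin (D - 1)) (Fin (D - 1)) ℝ)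
    - ((D : ℝ))⁻¹ • Matrix.of (fun _ _ => (1 : ℝ)))

/-- The variance of `x` under a probability vector `p` is at most half the sum of the squared
deviations of `x` from any point `m`. -/
lemma variance_le_half_sum_sq_sub {ι : Type*} [Fintype ι] (p x : ι → ℝ) (hp : ∀ i, 0 ≤ p i)
    (hsum : ∑ i, p i = 1) (m : ℝ) :
    ∑ i, p i * x i ^ 2 - (∑ i, p i * x i) ^ 2 ≤ 1 / 2 * ∑ i, (x i - m) ^ 2 := by
  set y : ι → ℝ := fun i => x i - m with hy
  have hshift : ∑ i, p i * x i ^ 2 - (∑ i, p i * x i) ^ 2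
      = ∑ i, p i * y i ^ 2 - (∑ i, p i * y i) ^ 2 := by
    have h₁ : ∑ i, p i * y i = ∑ i, p i * x i - m := by
      simp only [hy, mul_sub, Finset.sum_sub_distrib, ← Finset.sum_mul, hsum, one_mul]
    have h₂ : ∑ i, p i * y i ^ 2
        = ∑ i, p i * x i ^ 2 - 2 * m * ∑ i, p i * x i + m ^ 2 * ∑ i, p i := by
      simp only [Finset.mul_sum, ← Finset.sum_sub_distrib, ← Finset.sum_add_distrib, hy]
      exact Finset.sum_congr rfl fun i _ => by ring
    rw [h₁, h₂, hsum]
    ring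
  have hdiag : ∑ i, 4 * (p i ^ 2 * y i ^ 2) ≤ ∑ i, ∑ j, p i * p j * (y i + y j) ^ 2 := by
    refine Finset.sum_le_sum fun i _ => ?_
    have h := Finset.single_le_sum (f := fun j => p i * p j * (y i + y j) ^ 2)
      (fun j _ => mul_nonneg (mul_nonneg (hp i) (hp j)) (sq_nonneg _)) (Finset.mem_univ i)
    linarith
  have hexpand : ∑ i, ∑ j, p i * p j * (y i + y j) ^ 2
      = 2 * ∑ i, p i * y i ^ 2 + 2 * (∑ i, p i * y i) ^ 2 := by
    have h : ∀ i j, p i * p j * (y i + y j) ^ 2 = p i * y i ^ 2 * p j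
        + 2 * (p i * y i * (p j * y j)) + p i * (p j * y j ^ 2) := fun i j => by ring
    simp only [h, Finset.sum_add_distrib, ← Finset.mul_sum, ← Finset.sum_mul, hsum]
    ring
  have hcoeff : 2 * ∑ i, p i * y i ^ 2 - ∑ i, 2 * (p i ^ 2 * y i ^ 2)
      ≤ 1 / 2 * ∑ i, y i ^ 2 := by
    rw [Finset.mul_sum, Finset.mul_sum, ← Finset.sum_sub_distrib]
    exact Finset.sum_le_sum fun i _ => by nlinarith [sq_nonneg ((2 * p i - 1) * y i)]
  rw [← Finset.mul_sum] at hdiag hcoeff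
  rw [hshift]
  linarith

lemma dotProduct_bohningA_sub_lseHess_mulVec {D : ℕ} (ψ x : Fin (D - 1) → ℝ) :
    x ⬝ᵥ ((bohningA D - lseHess ψ) *ᵥ x)
      = 1 / 2 * (∑ i, x i ^ 2 - (D : ℝ)⁻¹ * (∑ i, x i) ^ 2)
        - (∑ i, probVec ψ i * x i ^ 2 - (∑ i, probVec ψ i * x i) ^ 2) := by
  have hones : (Matrix.of fun _ _ : Fin (D - 1) => (1 : ℝ)) *ᵥ x = fun _ => ∑ i, x i := by
    ext i
    simp [Matrix.mulVec, dotProduct]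
  have houter : (Matrix.of fun i j => probVec ψ i * probVec ψ j) *ᵥ x
      = fun i => probVec ψ i * ∑ j, probVec ψ j * x j := by
    ext i
    simp [Matrix.mulVec, dotProduct, Finset.mul_sum, mul_assoc]
  have hA : bohningA D *ᵥ x
      = fun i => 1 / 2 * (x i - (D : ℝ)⁻¹ * ∑ j, x j) := by
    rw [bohningA, Matrix.smul_mulVec, Matrix.sub_mulVec, Matrix.smul_mulVec, hones, Matrix.one_mulVec]
    rfl
  have hH : lseHess ψ *ᵥ x
      = fun i => probVec ψ i * x i - probVec ψ i * ∑ j, probVec ψ j * x j := by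
    rw [lseHess, Matrix.sub_mulVec, houter]
    ext i
    simp [Matrix.mulVec_diagonal]
  have hsub : (bohningA D - lseHess ψ) *ᵥ x
      = bohningA D *ᵥ x - lseHess ψ *ᵥ x := Matrix.sub_mulVec _ _ _
  rw [hsub, hA, hH]
  have h : ∀ i, x i * (1 / 2 * (x i - (D : ℝ)⁻¹ * ∑ j, x j)
      - (probVec ψ i * x i - probVec ψ i * ∑ j, probVec ψ j * x j))
      = 1 / 2 * (x i ^ 2 - (D : ℝ)⁻¹ * (x i * ∑ j, x j))
        - (probVec ψ i * x i ^ 2 - probVec ψ i * x i * ∑ j, probVec ψ j * x j) :=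
    fun i => by ring
  simp only [dotProduct, Pi.sub_apply]
  refine (Finset.sum_congr rfl fun i _ => h i).trans ?_
  simp only [Finset.sum_sub_distrib, ← Finset.mul_sum, ← Finset.sum_mul]
  ring

/-- (Böhning's curvature bound) For every `ψ`, the matrix
`A - (diag(p_ψ) - p_ψ p_ψᵀ)` is positive semidefinite. -/
theorem bohning_curvature_bound {D : ℕ} (hD : 2 ≤ D) (ψ : Fin (D - 1) → ℝ) :
    (bohningA D - lseHess ψ).PosSemidef := by
  have hD0 : (D : ℝ) ≠ 0 := by
    norm_cast
    omega
  have hcast : ((D - 1 : ℕ) : ℝ) = D - 1 := Nat.cast_pred (by omega)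
  refine Matrix.PosSemidef.of_dotProduct_mulVec_nonneg ?_ fun x => ?_
  · ext i j
    simp only [bohningA, lseHess, Matrix.conjTranspose_apply, Matrix.sub_apply,
      Matrix.smul_apply, Matrix.of_apply, Matrix.one_apply, Matrix.diagonal_apply, star_trivial,
      mul_comm (probVec ψ j), eq_comm (a := j)]
    split_ifs with h
    · rw [h]
    · rfl
  · have hZ : 0 < 1 + ∑ k, Real.exp (ψ k) := by positivity
    have hbound := variance_le_half_sum_sq_sub
      (fun o : Option (Fin (D - 1)) => o.elim (1 / (1 + ∑ k, Real.exp (ψ k))) (probVec ψ))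
      (fun o => o.elim 0 x)
      (by rintro (_ | i) <;> simp only [Option.elim, probVec] <;> positivity)
      (by
        simp only [Fintype.sum_option, Option.elim, probVec]
        rw [← Finset.sum_div, ← add_div, div_self hZ.ne'])
      ((D : ℝ)⁻¹ * ∑ i, x i)
    have hsq : ∀ m, ∑ i, (x i - m) ^ 2 = ∑ i, x i ^ 2 - 2 * m * ∑ i, x i + (D - 1 : ℕ) * m ^ 2 := by
      intro m
      simp only [sub_sq, Finset.sum_add_distrib, Finset.sum_sub_distrib, Finset.mul_sum]
      simp [mul_right_comm]
    simp only [Fintype.sum_option, Option.elim, hsq] at hbound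
    have hmean : (0 - (D : ℝ)⁻¹ * ∑ i, x i) ^ 2 + (∑ i, x i ^ 2
        - 2 * ((D : ℝ)⁻¹ * ∑ i, x i) * ∑ i, x i
        + (D - 1 : ℕ) * ((D : ℝ)⁻¹ * ∑ i, x i) ^ 2)
        = ∑ i, x i ^ 2 - (D : ℝ)⁻¹ * (∑ i, x i) ^ 2 := by
      rw [hcast]
      field_simp
      ring
    rw [hmean] at hbound
    have hquad := dotProduct_bohningA_sub_lseHess_mulVec ψ x
    refine le_of_le_of_eq ?_ hquad.symm
    norm_num at hbound ⊢
    linarith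
end

section
/- (Quadratic upper bound for log-sum-exp) For all η, ψ ∈ ℝ^{D−1}: lse(η) ≤ lse(ψ) + (η − ψ)ᵀ p_ψ + (1/2)(η − ψ)ᵀ A (η − ψ), where A = (1/2)(I_{D−1} − (1/D)·1 1ᵀ). -/
open scoped BigOperators
open Matrix

/-- The log-sum-exp function `lse(ψ) = log(1 + Σ_j exp(ψ_j))` on `ℝ^{D-1}`. -/
noncomputable def lse {n : ℕ} (ψ : Fin n → ℝ) : ℝ :=
  Real.log (1 + ∑ j, Real.exp (ψ j))

/-- **Hoeffding's lemma** for a probability vector on a finite type. -/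
theorem log_sum_mul_exp_le_hoeffding {ι : Type*} [Fintype ι] {p d : ι → ℝ} {a b : ℝ}
    (hp : ∀ i, 0 ≤ p i) (hp1 : ∑ i, p i = 1) (hd : ∀ i, d i ∈ Set.Icc a b) :
    Real.log (∑ i, p i * Real.exp (d i)) ≤ ∑ i, p i * d i + (b - a) ^ 2 / 8 := by
  let _ : MeasurableSpace ι := ⊤
  let q : PMF ι := PMF.ofFintype (fun i => ENNReal.ofReal (p i)) (by
    rw [← ENNReal.ofReal_sum_of_nonneg fun i _ => hp i, hp1, ENNReal.ofReal_one])
  have hint : ∀ f : ι → ℝ, ∫ i, f i ∂q.toMeasure = ∑ i, p i * f i := fun f => by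
    simp [PMF.integral_eq_sum, q, ENNReal.toReal_ofReal, hp]
  have hmgf := (ProbabilityTheory.hasSubgaussianMGF_of_mem_Icc (μ := q.toMeasure) (X := d)
    (measurable_from_top.aemeasurable) (Filter.Eventually.of_forall hd)).mgf_le 1
  rw [ProbabilityTheory.mgf, hint, hint] at hmgf
  have hfactor : ∑ i, p i * Real.exp (1 * (d i - ∑ j, p j * d j))
      = (∑ i, p i * Real.exp (d i)) * Real.exp (-∑ j, p j * d j) := by
    rw [Finset.sum_mul]
    refine Finset.sum_congr rfl fun i _ => ?_
    rw [one_mul, sub_eq_add_neg, Real.exp_add, mul_assoc]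
  have hpos : 0 < ∑ i, p i * Real.exp (d i) := by
    obtain ⟨i, -, hi⟩ := Finset.exists_ne_zero_of_sum_ne_zero (hp1.trans_ne one_ne_zero)
    exact Finset.sum_pos' (fun i _ => mul_nonneg (hp i) (Real.exp_pos _).le)
      ⟨i, Finset.mem_univ i, mul_pos ((hp i).lt_of_ne' hi) (Real.exp_pos _)⟩
  rw [hfactor] at hmgf
  have hlog := Real.log_le_log (mul_pos hpos (Real.exp_pos _)) hmgf
  rw [Real.log_mul hpos.ne' (Real.exp_pos _).ne', Real.log_exp, Real.log_exp] at hlog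
  have hc : (((‖b - a‖₊ / 2) ^ 2 : NNReal) : ℝ) * 1 ^ 2 / 2 = (b - a) ^ 2 / 8 := by
    push_cast
    rw [Real.norm_eq_abs, div_pow, sq_abs]
    ring
  linarith

/-- The squared gap between two entries is at most twice the sum of squared deviations. -/
theorem sq_sub_le_two_mul_sum_sq_sub {ι : Type*} [Fintype ι] (d : ι → ℝ) (m : ℝ) (i j : ι) :
    (d j - d i) ^ 2 ≤ 2 * ∑ k, (d k - m) ^ 2 := by
  classical
  have hnonneg : 0 ≤ ∑ k, (d k - m) ^ 2 := Finset.sum_nonneg fun k _ => sq_nonneg _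
  rcases eq_or_ne i j with rfl | hij
  · simpa using hnonneg
  · have hpair : ∑ k ∈ {i, j}, (d k - m) ^ 2 ≤ ∑ k, (d k - m) ^ 2 :=
      Finset.sum_le_sum_of_subset_of_nonneg (Finset.subset_univ _) fun k _ _ => sq_nonneg _
    rw [Finset.sum_pair hij] at hpair
    nlinarith [sq_nonneg ((d i - m) + (d j - m))]

theorem log_sum_mul_exp_le {ι : Type*} [Fintype ι] [Nonempty ι] {p : ι → ℝ} (d : ι → ℝ)
    (hp : ∀ i, 0 ≤ p i) (hp1 : ∑ i, p i = 1) (m : ℝ) :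
    Real.log (∑ i, p i * Real.exp (d i)) ≤ ∑ i, p i * d i + (1 / 4) * ∑ i, (d i - m) ^ 2 := by
  obtain ⟨i, hi⟩ := Finite.exists_min d
  obtain ⟨j, hj⟩ := Finite.exists_max d
  linarith [log_sum_mul_exp_le_hoeffding hp hp1 fun k => ⟨hi k, hj k⟩,
    sq_sub_le_two_mul_sum_sq_sub d m i j]

theorem bohningA_quadraticForm {D : ℕ} (v : Fin (D - 1) → ℝ) :
    v ⬝ᵥ (bohningA D).mulVec v = (1 / 2) * (∑ i, v i ^ 2 - (D : ℝ)⁻¹ * (∑ i, v i) ^ 2) := by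
  have hones : (Matrix.of fun _ _ => (1 : ℝ)).mulVec v = fun _ : Fin (D - 1) => ∑ i, v i := by
    ext i
    simp [Matrix.mulVec, dotProduct]
  rw [bohningA, Matrix.smul_mulVec, Matrix.sub_mulVec, Matrix.one_mulVec, Matrix.smul_mulVec,
    hones, dotProduct_smul, dotProduct_sub, dotProduct_smul]
  simp only [dotProduct, smul_eq_mul, ← Finset.sum_mul, sq]

theorem lse_eq_add_log {n : ℕ} (η ψ : Fin n → ℝ) :
    lse η = lse ψ + Real.log ((1 + ∑ k, Real.exp (ψ k))⁻¹
      + ∑ j, probVec ψ j * Real.exp ((η - ψ) j)) := by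
  have hZ (φ : Fin n → ℝ) : 0 < 1 + ∑ k, Real.exp (φ k) := by positivity
  have hratio : (1 + ∑ k, Real.exp (ψ k))⁻¹ + ∑ j, probVec ψ j * Real.exp ((η - ψ) j)
      = (1 + ∑ k, Real.exp (η k)) / (1 + ∑ k, Real.exp (ψ k)) := by
    rw [add_div, one_div, Finset.sum_div]
    congr 1
    refine Finset.sum_congr rfl fun j _ => ?_
    rw [probVec, div_mul_eq_mul_div, ← Real.exp_add, Pi.sub_apply, add_sub_cancel]
  rw [hratio, Real.log_div (hZ η).ne' (hZ ψ).ne', lse, lse]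
  ring

/-- (Quadratic upper bound for log-sum-exp) For all `η, ψ ∈ ℝ^{D-1}`:
`lse(η) ≤ lse(ψ) + (η - ψ)ᵀ p_ψ + (1/2)(η - ψ)ᵀ A (η - ψ)`. -/
theorem lse_quadratic_upper_bound {D : ℕ} (hD : 2 ≤ D) (η ψ : Fin (D - 1) → ℝ) :
    lse η ≤ lse ψ + (η - ψ) ⬝ᵥ probVec ψ
      + (1 / 2) * ((η - ψ) ⬝ᵥ (bohningA D).mulVec (η - ψ)) := by
  have hZ : 0 < 1 + ∑ k, Real.exp (ψ k) := by positivity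
  let p : Option (Fin (D - 1)) → ℝ := fun o => o.elim (1 + ∑ k, Real.exp (ψ k))⁻¹ (probVec ψ)
  let d : Option (Fin (D - 1)) → ℝ := fun o => o.elim 0 (η - ψ)
  have hp : ∀ o, 0 ≤ p o := by
    rintro (_ | j)
    · exact (inv_pos.2 hZ).le
    · exact div_nonneg (Real.exp_pos _).le hZ.le
  have hp1 : ∑ o, p o = 1 := by
    simp only [p, Fintype.sum_option, Option.elim_none, Option.elim_some, probVec,
      ← Finset.sum_div]
    field_simp
  have hD0 : (D : ℝ) ≠ 0 := by
    norm_cast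
    lia
  have hbound := log_sum_mul_exp_le d hp hp1 ((D : ℝ)⁻¹ * ∑ i, (η - ψ) i)
  simp only [p, d, Fintype.sum_option, Option.elim_none, Option.elim_some, Real.exp_zero,
    mul_one, mul_zero, zero_add] at hbound
  have hsq (m : ℝ) : ∑ i, ((η - ψ) i - m) ^ 2
      = ∑ i, (η - ψ) i ^ 2 - 2 * m * ∑ i, (η - ψ) i + (D - 1) * m ^ 2 := by
    simp only [sub_sq, Finset.sum_add_distrib, Finset.sum_sub_distrib, Finset.sum_const,
      Finset.card_univ, Fintype.card_fin, nsmul_eq_mul, Nat.cast_pred (by lia : 0 < D),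
      ← Finset.sum_mul, ← Finset.mul_sum]
    ring
  rw [hsq] at hbound
  rw [lse_eq_add_log η ψ, bohningA_quadraticForm, dotProduct_comm, dotProduct, add_assoc]
  gcongr
  refine hbound.trans_eq ?_
  field_simp
  ring
end

section
/- (Kronecker-structured posterior covariance: explicit inverse) Let K, P ≥ 1 and D ≥ 2 be integers, C ∈ ℝ^{K×P}, and N = diag(N_1, …, N_P) with N_i ≥ 0 for all i. Define A = (1/2)(I_{D−1} − (1/D)·1 1ᵀ) ∈ ℝ^{(D−1)×(D−1)}, F = (1/2) C N Cᵀ + I_K, G = (F − I_K)/D, and Δ = F^{−1} G (I_K + (D−1)(G + I_K)^{−1} G) F^{−1}. Then F and G + I_K are invertible, and (I_{D−1} ⊗ F^{−1} + 1 1ᵀ ⊗ Δ) · (A ⊗ (C N Cᵀ) + I_{(D−1)K}) = I_{(D−1)K}, where ⊗ denotes the Kronecker product and 1 ∈ ℝ^{D−1} is the all-ones vector. -/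
open scoped Kronecker
open Matrix

/-- The rank-one-update inverse identity for `1 ⊗ F - J ⊗ G`, where `J` is the all-ones matrix. -/
theorem one_kronecker_add_ones_kronecker_mul {ι κ R : Type*} [Fintype ι] [DecidableEq ι]
    [Fintype κ] [DecidableEq κ] [CommRing R] (F F' G Δ : Matrix κ κ R) (hF : F' * F = 1)
    (hΔ : Δ * (F - (Fintype.card ι : R) • G) = F' * G) :
    ((1 : Matrix ι ι R) ⊗ₖ F' + (Matrix.of (fun _ _ => (1 : R)) : Matrix ι ι R) ⊗ₖ Δ)
      * ((1 : Matrix ι ι R) ⊗ₖ F - (Matrix.of (fun _ _ => (1 : R)) : Matrix ι ι R) ⊗ₖ G) = 1 := by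
  have hJ : (Matrix.of (fun _ _ => (1 : R)) : Matrix ι ι R) * Matrix.of (fun _ _ => (1 : R))
      = (Fintype.card ι : R) • Matrix.of (fun _ _ => (1 : R)) := by
    ext i j
    simp [Matrix.mul_apply]
  rw [add_mul, mul_sub, mul_sub, ← mul_kronecker_mul, ← mul_kronecker_mul, ← mul_kronecker_mul,
    ← mul_kronecker_mul, hJ, hF, ← hΔ, mul_sub, Matrix.mul_smul, smul_kronecker]
  simp only [one_mul, mul_one, one_kronecker_one]
  ext ⟨i, k⟩ ⟨j, l⟩
  simp

/-- A nonnegative multiple of `C * diagonal v * Cᵀ` with `0 ≤ v`, plus the identity, is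
invertible. -/
theorem isUnit_smul_mul_diagonal_mul_transpose_add_one {κ π : Type*} [Fintype κ] [DecidableEq κ]
    [Fintype π] [DecidableEq π] (C : Matrix κ π ℝ) (v : π → ℝ) (hv : ∀ i, 0 ≤ v i)
    {c : ℝ} (hc : 0 ≤ c) : IsUnit (c • (C * Matrix.diagonal v * Cᵀ) + 1) := by
  have h : (C * Matrix.diagonal v * Cᵀ).PosSemidef := by
    simpa using (PosSemidef.diagonal (d := v) hv).mul_mul_conjTranspose_same C
  exact (PosDef.posSemidef_add (h.smul hc) PosDef.one).isUnit

/-- (Kronecker-structured posterior covariance: explicit inverse) With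
`F = (1/2) C N Cᵀ + I`, `G = (F - I)/D`, and
`Δ = F⁻¹ G (I + (D-1)(G+I)⁻¹ G) F⁻¹`, the matrices `F` and `G + I` are
invertible and `(I ⊗ F⁻¹ + 1 1ᵀ ⊗ Δ)(A ⊗ (C N Cᵀ) + I) = I`. -/
theorem kronecker_posterior_covariance_inverse {K P D : ℕ}
    (hK : 1 ≤ K) (hP : 1 ≤ P) (hD : 2 ≤ D)
    (C : Matrix (Fin K) (Fin P) ℝ) (Nv : Fin P → ℝ) (hN : ∀ i, 0 ≤ Nv i) :
    let Nm : Matrix (Fin P) (Fin P) ℝ := Matrix.diagonal Nv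
    let A : Matrix (Fin (D - 1)) (Fin (D - 1)) ℝ :=
      (1 / 2 : ℝ) • ((1 : Matrix (Fin (D - 1)) (Fin (D - 1)) ℝ)
        - ((D : ℝ))⁻¹ • Matrix.of (fun _ _ => (1 : ℝ)))
    let F : Matrix (Fin K) (Fin K) ℝ := (1 / 2 : ℝ) • (C * Nm * Cᵀ) + 1
    let G : Matrix (Fin K) (Fin K) ℝ := ((D : ℝ))⁻¹ • (F - 1)
    let Δ : Matrix (Fin K) (Fin K) ℝ :=
      F⁻¹ * G * (1 + ((D : ℝ) - 1) • ((G + 1)⁻¹ * G)) * F⁻¹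
    IsUnit F ∧ IsUnit (G + 1) ∧
      ((1 : Matrix (Fin (D - 1)) (Fin (D - 1)) ℝ) ⊗ₖ F⁻¹
          + (Matrix.of (fun _ _ => (1 : ℝ)) : Matrix (Fin (D - 1)) (Fin (D - 1)) ℝ) ⊗ₖ Δ)
        * (A ⊗ₖ (C * Nm * Cᵀ) + 1) = 1 := by
  intro Nm A F G Δ
  have hD0 : (D : ℝ) ≠ 0 := by positivity
  have hF : IsUnit F :=
    isUnit_smul_mul_diagonal_mul_transpose_add_one C Nv hN (by norm_num)
  have hG : IsUnit (G + 1) := by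
    have h : G + 1 = ((D : ℝ)⁻¹ * (1 / 2)) • (C * Matrix.diagonal Nv * Cᵀ) + 1 := by
      simp only [G, F, Nm, add_sub_cancel_right, smul_smul]
    rw [h]
    exact isUnit_smul_mul_diagonal_mul_transpose_add_one C Nv hN (by positivity)
  refine ⟨hF, hG, ?_⟩
  have hF' := (Matrix.isUnit_iff_isUnit_det _).1 hF
  have hG' := (Matrix.isUnit_iff_isUnit_det _).1 hG
  have hDG : (D : ℝ) • G = F - 1 := by simp only [G, smul_smul, mul_inv_cancel₀ hD0, one_smul]
  have hcard : (Fintype.card (Fin (D - 1)) : ℝ) = (D : ℝ) - 1 := by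
    rw [Fintype.card_fin, Nat.cast_sub (by omega), Nat.cast_one]
  have hFG : F - ((D : ℝ) - 1) • G = G + 1 := by
    rw [sub_smul, hDG, one_smul]
    abel
  have hmid : 1 + ((D : ℝ) - 1) • ((G + 1)⁻¹ * G) = (G + 1)⁻¹ * F := by
    have h : F = G + 1 + ((D : ℝ) - 1) • G := by rw [← hFG, sub_add_cancel]
    conv_rhs => arg 2; rw [h]
    rw [mul_add, Matrix.nonsing_inv_mul _ hG', Matrix.mul_smul (G + 1)⁻¹ ((D : ℝ) - 1) G]
  have hΔ : Δ * (F - (Fintype.card (Fin (D - 1)) : ℝ) • G) = F⁻¹ * G := by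
    rw [hcard, hFG]
    simp only [Δ]
    rw [hmid, mul_assoc _ _ F⁻¹, mul_assoc _ F, Matrix.mul_nonsing_inv _ hF', mul_one, mul_assoc,
      Matrix.nonsing_inv_mul _ hG', mul_one]
  have hA : A ⊗ₖ (C * Nm * Cᵀ) + 1 = (1 : Matrix (Fin (D - 1)) (Fin (D - 1)) ℝ) ⊗ₖ F
      - (Matrix.of (fun _ _ => (1 : ℝ)) : Matrix (Fin (D - 1)) (Fin (D - 1)) ℝ) ⊗ₖ G := by
    rw [← one_kronecker_one]
    ext ⟨i, k⟩ ⟨j, l⟩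
    simp only [A, G, F, Matrix.add_apply, Matrix.sub_apply, Matrix.smul_apply, kronecker_apply,
      Matrix.of_apply, smul_eq_mul]
    ring
  rw [hA]
  exact one_kronecker_add_ones_kronecker_mul F F⁻¹ G Δ (Matrix.nonsing_inv_mul _ hF') hΔ
end

section
/- (Gaussian expectation of the multinomial quadratic form — Proposition 1 core identity) Let K ≥ 1 and D ≥ 2 be integers, c ∈ ℝ^K, F, Δ ∈ ℝ^{K×K}, and let φ_1, …, φ_{D−1} ∈ ℝ^K be the columns of Φ ∈ ℝ^{K×(D−1)}. Set Ω = I_{D−1} ⊗ F + 1 1ᵀ ⊗ Δ, ω = (φ_1ᵀ, …, φ_{D−1}ᵀ)ᵀ, C_c = I_{D−1} ⊗ c ∈ ℝ^{(D−1)K×(D−1)}, and A = (1/2)(I_{D−1} − (1/D)·1 1ᵀ). Then trace(C_c A C_cᵀ (Ω + ω ωᵀ)) = cᵀ ( ((D−1)²/(2D)) F + ((D−1)/(2D)) Δ + (1/2) Φ Φᵀ − (1/(2D)) (Φ 1)(Φ 1)ᵀ ) c. -/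
open scoped Kronecker
open Matrix

namespace Matrix

variable {ι κ R : Type*} [Fintype ι] [Fintype κ] [CommRing R]

theorem dotProduct_mul_transpose_mulVec (c : κ → R) (Φ : Matrix κ ι R) :
    c ⬝ᵥ (Φ * Φᵀ) *ᵥ c = (Φᵀ *ᵥ c) ⬝ᵥ (Φᵀ *ᵥ c) := by
  rw [← mulVec_mulVec, dotProduct_mulVec, mulVec_transpose]

theorem dotProduct_vecMulVec_mulVec (c p : κ → R) :
    c ⬝ᵥ vecMulVec p p *ᵥ c = (c ⬝ᵥ p) ^ 2 := by
  rw [vecMulVec_mulVec, dotProduct_smul, dotProduct_comm p c]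
  simp [sq]

variable [DecidableEq ι]

/-- The Kronecker product `I ⊗ c` of the identity matrix with a column vector. -/
def oneKroneckerCol (ι : Type*) [DecidableEq ι] (c : κ → R) : Matrix (ι × κ) ι R :=
  of fun jk j => (1 : Matrix ι ι R) jk.1 j * c jk.2

theorem oneKroneckerCol_transpose_mul_apply (c : κ → R) {m : Type*} (M : Matrix (ι × κ) m R)
    (i : ι) (x : m) : ((oneKroneckerCol ι c)ᵀ * M) i x = ∑ k, c k * M (i, k) x := by
  simp only [mul_apply, transpose_apply, oneKroneckerCol, of_apply, Fintype.sum_prod_type,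
    one_apply]
  rw [Finset.sum_eq_single i] <;> simp +contextual

theorem mul_oneKroneckerCol_apply (c : κ → R) {m : Type*} (M : Matrix m (ι × κ) R)
    (x : m) (j : ι) : (M * oneKroneckerCol ι c) x j = ∑ k, M x (j, k) * c k := by
  simp only [mul_apply, oneKroneckerCol, of_apply, Fintype.sum_prod_type, one_apply]
  rw [Finset.sum_eq_single j] <;> simp +contextual

theorem oneKroneckerCol_congr_kronecker (c : κ → R) (B : Matrix ι ι R) (G : Matrix κ κ R) :
    (oneKroneckerCol ι c)ᵀ * (B ⊗ₖ G) * oneKroneckerCol ι c = (c ⬝ᵥ G *ᵥ c) • B := by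
  ext i j
  simp only [oneKroneckerCol_transpose_mul_apply, mul_oneKroneckerCol_apply,
    kroneckerMap_apply, smul_apply, smul_eq_mul, dotProduct, mulVec, Finset.sum_mul,
    Finset.mul_sum]
  rw [Finset.sum_comm]
  exact Finset.sum_congr rfl fun k _ => Finset.sum_congr rfl fun l _ => by ring

theorem oneKroneckerCol_congr_vecMulVec (c : κ → R) (w : ι × κ → R) :
    (oneKroneckerCol ι c)ᵀ * vecMulVec w w * oneKroneckerCol ι c =
      vecMulVec (fun i => ∑ k, w (i, k) * c k) (fun i => ∑ k, w (i, k) * c k) := by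
  ext i j
  simp only [oneKroneckerCol_transpose_mul_apply, mul_oneKroneckerCol_apply,
    vecMulVec_apply, Finset.sum_mul, Finset.mul_sum]
  exact Finset.sum_congr rfl fun k _ => Finset.sum_congr rfl fun l _ => by ring

end Matrix

/-- (Gaussian expectation of the multinomial quadratic form — Proposition 1 core
identity) With `Ω = I ⊗ F + 1 1ᵀ ⊗ Δ`, `ω` the stacked columns of `Φ`,
`C_c = I_{D-1} ⊗ c`, and `A = (1/2)(I_{D-1} - (1/D) 1 1ᵀ)`:
`trace(C_c A C_cᵀ (Ω + ωωᵀ)) = cᵀ(((D-1)²/(2D))F + ((D-1)/(2D))Δ + (1/2)ΦΦᵀ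
  - (1/(2D))(Φ1)(Φ1)ᵀ)c`. -/
theorem gaussian_expectation_multinomial_quadratic {K D : ℕ} (hK : 1 ≤ K) (hD : 2 ≤ D)
    (c : Fin K → ℝ) (F Δ : Matrix (Fin K) (Fin K) ℝ)
    (Φ : Matrix (Fin K) (Fin (D - 1)) ℝ) :
    let A : Matrix (Fin (D - 1)) (Fin (D - 1)) ℝ :=
      (1 / 2 : ℝ) • ((1 : Matrix (Fin (D - 1)) (Fin (D - 1)) ℝ)
        - ((D : ℝ))⁻¹ • Matrix.of (fun _ _ => (1 : ℝ)))
    let Ω : Matrix (Fin (D - 1) × Fin K) (Fin (D - 1) × Fin K) ℝ :=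
      (1 : Matrix (Fin (D - 1)) (Fin (D - 1)) ℝ) ⊗ₖ F
        + (Matrix.of (fun _ _ => (1 : ℝ)) : Matrix (Fin (D - 1)) (Fin (D - 1)) ℝ) ⊗ₖ Δ
    let ω : Fin (D - 1) × Fin K → ℝ := fun jk => Φ jk.2 jk.1
    -- `C_c = I_{D-1} ⊗ c`, a `(D-1)K × (D-1)` block matrix
    let Cc : Matrix (Fin (D - 1) × Fin K) (Fin (D - 1)) ℝ :=
      Matrix.of fun jk j' =>
        (1 : Matrix (Fin (D - 1)) (Fin (D - 1)) ℝ) jk.1 j' * c jk.2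
    let Φone : Fin K → ℝ := Φ.mulVec (fun _ => 1)
    Matrix.trace (Cc * A * Ccᵀ * (Ω + Matrix.vecMulVec ω ω))
      = c ⬝ᵥ ((((D : ℝ) - 1) ^ 2 / (2 * D)) • F + (((D : ℝ) - 1) / (2 * D)) • Δ
          + (1 / 2 : ℝ) • (Φ * Φᵀ)
          - (1 / (2 * D) : ℝ) • Matrix.vecMulVec Φone Φone).mulVec c := by
  intro A Ω ω Cc Φone
  have hD0 : (D : ℝ) ≠ 0 := by positivity
  have hn : ((D - 1 : ℕ) : ℝ) = D - 1 := by
    rw [Nat.cast_sub (by lia), Nat.cast_one]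
  have hCc : Cc = oneKroneckerCol (Fin (D - 1)) c := rfl
  have hω : (fun i => ∑ k, ω (i, k) * c k) = Φᵀ *ᵥ c := rfl
  have hΦone : c ⬝ᵥ Φone = ∑ i, (Φᵀ *ᵥ c) i := by
    rw [dotProduct_mulVec, mulVec_transpose]
    simp only [dotProduct, mul_one]
  have hcycle : trace (Cc * A * Ccᵀ * (Ω + vecMulVec ω ω))
      = trace (A * (Ccᵀ * (Ω + vecMulVec ω ω) * Cc)) := by
    rw [Matrix.mul_assoc, Matrix.mul_assoc, trace_mul_comm]
    simp only [Matrix.mul_assoc]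
  have htrace (M : Matrix (Fin (D - 1)) (Fin (D - 1)) ℝ) :
      trace (A * M) = 1 / 2 * (trace M - (D : ℝ)⁻¹ * ∑ i, ∑ j, M i j) := by
    have hJ : trace (of (fun _ _ => (1 : ℝ)) * M) = ∑ i, ∑ j, M i j := by
      simp only [trace, diag_apply, mul_apply, of_apply, one_mul]
      exact Finset.sum_comm
    simp only [A, smul_mul, Matrix.sub_mul, Matrix.one_mul, trace_smul, trace_sub, hJ,
      smul_eq_mul]
  have hsum : ∑ i, ∑ j, vecMulVec (Φᵀ *ᵥ c) (Φᵀ *ᵥ c) i j = (∑ i, (Φᵀ *ᵥ c) i) ^ 2 := by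
    simp only [vecMulVec_apply, sq, Finset.sum_mul_sum]
  have hcongr : Ccᵀ * (Ω + vecMulVec ω ω) * Cc = (c ⬝ᵥ F *ᵥ c) • 1
      + (c ⬝ᵥ Δ *ᵥ c) • of (fun _ _ => 1) + vecMulVec (Φᵀ *ᵥ c) (Φᵀ *ᵥ c) := by
    simp only [hCc, Ω, Matrix.mul_add, Matrix.add_mul, oneKroneckerCol_congr_kronecker,
      oneKroneckerCol_congr_vecMulVec, hω]
  rw [hcycle, hcongr]
  simp only [Matrix.mul_add, Matrix.mul_smul, trace_add, trace_smul, htrace, hsum,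
    trace_vecMulVec, add_mulVec, sub_mulVec, smul_mulVec, dotProduct_add, dotProduct_sub,
    dotProduct_smul, dotProduct_mul_transpose_mulVec, dotProduct_vecMulVec_mulVec, hΦone]
  simp only [trace, diag_apply, one_apply, of_apply, Finset.sum_ite_eq,
    Finset.mem_univ, if_true, Finset.sum_const, Finset.card_univ, Fintype.card_fin,
    nsmul_eq_mul, mul_one, hn, smul_eq_mul]
  field_simp
  ring
end
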